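/- arXiv:1905.08707 — 2 statements merged into one kernel-verified Lean document; each statement's English description precedes it below -/
import Mathlib

section
/- Let b : ℝ^d → ℝ^d be continuously differentiable, a : ℝ^d → ℝ^{d×d} symmetric and twice continuously differentiable, f : ℝ^d → ℝ twice continuously differentiable, and φ : ℝ → ℝ twice continuously differentiable. Then pointwise on ℝ^d: L*(φ∘f) = φ′(f)·L*f + (1/2)·φ″(f)·⟨a∇f, ∇f⟩ + (f·φ′(f) − φ(f))·Σ_i ∂_{x_i}( b_i − (1/2)Σ_j ∂_{x_j} a_{ij} ). -/
open MeasureTheory Set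

noncomputable section

/-- Partial derivative `∂_{x_i} f(x)` on `ℝ^d = (Fin d → ℝ)`. -/
def pd {d : ℕ} (f : (Fin d → ℝ) → ℝ) (i : Fin d) (x : Fin d → ℝ) : ℝ :=
  fderiv ℝ f x (Pi.single i 1)

/-- Second partial derivative `∂²_{x_i x_j} f(x)`. -/
def pd2 {d : ℕ} (f : (Fin d → ℝ) → ℝ) (i j : Fin d) (x : Fin d → ℝ) : ℝ :=
  pd (pd f j) i x

/-- Generator `L f = Σ_i b_i ∂_{x_i} f + ½ Σ_{i,j} a_{ij} ∂²_{x_i x_j} f`. -/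
def gen {d : ℕ} (b : (Fin d → ℝ) → Fin d → ℝ) (a : (Fin d → ℝ) → Fin d → Fin d → ℝ)
    (f : (Fin d → ℝ) → ℝ) (x : Fin d → ℝ) : ℝ :=
  (∑ i, b x i * pd f i x) + (1 / 2) * ∑ i, ∑ j, a x i j * pd2 f i j x

/-- Formal `L²(dx)`-adjoint `L* ρ = −Σ_i ∂_{x_i}(b_i ρ) + ½ Σ_{i,j} ∂²_{x_i x_j}(a_{ij} ρ)`. -/
def adj {d : ℕ} (b : (Fin d → ℝ) → Fin d → ℝ) (a : (Fin d → ℝ) → Fin d → Fin d → ℝ)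
    (ρ : (Fin d → ℝ) → ℝ) (x : Fin d → ℝ) : ℝ :=
  (- ∑ i, pd (fun y => b y i * ρ y) i x)
    + (1 / 2) * ∑ i, ∑ j, pd2 (fun y => a y i j * ρ y) i j x

section PartialDerivatives

variable {d : ℕ} {g h : (Fin d → ℝ) → ℝ} {φ : ℝ → ℝ} {x : Fin d → ℝ}

theorem differentiable_pd (hg : ContDiff ℝ 2 g) (i : Fin d) : Differentiable ℝ (pd g i) :=
  ((hg.fderiv_right (m := 1) (by norm_num)).clm_apply contDiff_const).differentiable (by norm_num)

theorem pd_add (hg : DifferentiableAt ℝ g x) (hh : DifferentiableAt ℝ h x) (i : Fin d) :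
    pd (fun y => g y + h y) i x = pd g i x + pd h i x := by
  simp [pd, fderiv_fun_add hg hh]

theorem pd_sub (hg : DifferentiableAt ℝ g x) (hh : DifferentiableAt ℝ h x) (i : Fin d) :
    pd (fun y => g y - h y) i x = pd g i x - pd h i x := by
  simp [pd, fderiv_fun_sub hg hh]

theorem pd_const_mul (hg : DifferentiableAt ℝ g x) (c : ℝ) (i : Fin d) :
    pd (fun y => c * g y) i x = c * pd g i x := by
  simp [pd, fderiv_const_mul hg]

theorem pd_sum {ι : Type*} {s : Finset ι} {g : ι → (Fin d → ℝ) → ℝ}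
    (hg : ∀ k ∈ s, DifferentiableAt ℝ (g k) x) (i : Fin d) :
    pd (fun y => ∑ k ∈ s, g k y) i x = ∑ k ∈ s, pd (g k) i x := by
  simp [pd, fderiv_fun_sum hg]

theorem pd_mul (hg : DifferentiableAt ℝ g x) (hh : DifferentiableAt ℝ h x) (i : Fin d) :
    pd (fun y => g y * h y) i x = pd g i x * h x + g x * pd h i x := by
  simp [pd, fderiv_fun_mul hg hh]
  ring

theorem pd_comp (hφ : DifferentiableAt ℝ φ (g x)) (hg : DifferentiableAt ℝ g x) (i : Fin d) :
    pd (fun y => φ (g y)) i x = deriv φ (g x) * pd g i x := by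
  have := (hφ.hasDerivAt.comp_hasFDerivAt x hg.hasFDerivAt).fderiv
  simp only [Function.comp_def] at this
  simp [pd, this]

theorem pd2_mul (hg : ContDiff ℝ 2 g) (hh : ContDiff ℝ 2 h) (i j : Fin d) :
    pd2 (fun y => g y * h y) i j x
      = pd2 g i j x * h x + pd g j x * pd h i x + (pd g i x * pd h j x + g x * pd2 h i j x) := by
  have dg : Differentiable ℝ g := hg.differentiable (by norm_num)
  have dh : Differentiable ℝ h := hh.differentiable (by norm_num)
  have dpg := differentiable_pd hg j
  have dph := differentiable_pd hh j
  have key : pd (fun y => g y * h y) j = fun y => pd g j y * h y + g y * pd h j y :=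
    funext fun y => pd_mul (dg y) (dh y) j
  rw [pd2, key, pd_add ((dpg x).fun_mul (dh x)) ((dg x).fun_mul (dph x)), pd_mul (dpg x) (dh x),
    pd_mul (dg x) (dph x), pd2, pd2]

theorem pd2_comp (hφ : ContDiff ℝ 2 φ) (hg : ContDiff ℝ 2 g) (i j : Fin d) :
    pd2 (fun y => φ (g y)) i j x
      = deriv (deriv φ) (g x) * pd g i x * pd g j x + deriv φ (g x) * pd2 g i j x := by
  have dg : Differentiable ℝ g := hg.differentiable (by norm_num)
  have dφ : Differentiable ℝ φ := hφ.differentiable (by norm_num)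
  have dφ' : Differentiable ℝ (deriv φ) :=
    (hφ.deriv' (n := 1)).differentiable (by norm_num)
  have key : pd (fun y => φ (g y)) j = fun y => deriv φ (g y) * pd g j y :=
    funext fun y => pd_comp (dφ (g y)) (dg y) j
  rw [pd2, key, pd_mul ((dφ' (g x)).fun_comp' x (dg x)) (differentiable_pd hg j x),
    pd_comp (dφ' (g x)) (dg x), pd2]

end PartialDerivatives

/-- chain-rule identity for the Fokker–Planck adjoint:
`L*(φ∘f) = φ′(f)·L*f + ½ φ″(f)⟨a∇f,∇f⟩ + (f·φ′(f) − φ(f))·div(b − ½∇·a)`. -/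
theorem adjoint_chain_rule (d : ℕ)
    (b : (Fin d → ℝ) → Fin d → ℝ) (a : (Fin d → ℝ) → Fin d → Fin d → ℝ)
    (hb : ∀ i, ContDiff ℝ 1 fun y => b y i)
    (ha : ∀ i j, ContDiff ℝ 2 fun y => a y i j)
    (hsymm : ∀ y i j, a y i j = a y j i)
    (f : (Fin d → ℝ) → ℝ) (hf : ContDiff ℝ 2 f)
    (φ : ℝ → ℝ) (hφ : ContDiff ℝ 2 φ)
    (x : Fin d → ℝ) :
    adj b a (fun y => φ (f y)) x
      = deriv φ (f x) * adj b a f x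
        + (1 / 2) * deriv (deriv φ) (f x) * (∑ i, ∑ j, a x i j * pd f j x * pd f i x)
        + (f x * deriv φ (f x) - φ (f x)) *
            ∑ i, pd (fun y => b y i - (1 / 2) * ∑ j, pd (fun z => a z i j) j y) i x := by
  have df : Differentiable ℝ f := hf.differentiable (by norm_num)
  have dφ : Differentiable ℝ φ := hφ.differentiable (by norm_num)
  have db (i) : Differentiable ℝ fun y => b y i := (hb i).differentiable (by norm_num)
  have dpa (i j) := differentiable_pd (ha i j) j
  have hφf : ContDiff ℝ 2 fun y => φ (f y) := hφ.comp hf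
  have first_order (i) : pd (fun y => b y i * φ (f y)) i x
      = deriv φ (f x) * pd (fun y => b y i * f y) i x
        - (f x * deriv φ (f x) - φ (f x)) * pd (fun y => b y i) i x := by
    rw [pd_mul (db i x) (hφf.differentiable (by norm_num) x), pd_mul (db i x) (df x),
      pd_comp (dφ _) (df x)]
    ring
  have second_order (i j) : pd2 (fun y => a y i j * φ (f y)) i j x
      = deriv φ (f x) * pd2 (fun y => a y i j * f y) i j x
        + deriv (deriv φ) (f x) * (a x i j * pd f j x * pd f i x)
        - (f x * deriv φ (f x) - φ (f x)) * pd2 (fun y => a y i j) i j x := by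
    rw [pd2_mul (ha i j) hφf, pd2_mul (ha i j) hf, pd2_comp hφ hf, pd_comp (dφ _) (df x),
      pd_comp (dφ _) (df x)]
    ring
  have divergence (i) : pd (fun y => b y i - (1 / 2) * ∑ j, pd (fun z => a z i j) j y) i x
      = pd (fun y => b y i) i x - (1 / 2) * ∑ j, pd2 (fun z => a z i j) i j x := by
    have dsum : DifferentiableAt ℝ (fun y => ∑ j, pd (fun z => a z i j) j y) x :=
      DifferentiableAt.fun_sum fun j _ => dpa i j x
    rw [pd_sub (db i x) (dsum.const_mul _), pd_const_mul dsum, pd_sum fun j _ => dpa i j x]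
    rfl
  simp only [adj, first_order, second_order, divergence, Finset.sum_add_distrib,
    Finset.sum_sub_distrib, ← Finset.mul_sum]
  ring

end
end

section
/- Let (Ω, F) be a measurable space, Q and P probability measures on F, and (F_n)_{n∈ℕ} an increasing sequence of sub-σ-algebras of F with σ(⋃_n F_n) = F. Assume Q|_{F_n} ≪ P|_{F_n} for every n and set D_n := d(Q|_{F_n})/d(P|_{F_n}). Then (D_n) converges P-almost surely, and writing Q = Q^{ac} + Q^{s} for the Lebesgue decomposition of Q with respect to P: for every A ∈ F, Q^{ac}(A) = ∫_A (lim_n D_n) dP and Q^{s}(A) = Q( A ∩ { limsup_n D_n = ∞ } ). In particular, Q ≪ P if and only if Q({ limsup_n D_n = ∞ }) = 0, and Q ⊥ P if and only if Q({ limsup_n D_n = ∞ }) = 1. -/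
open MeasureTheory Filter
open scoped ENNReal

namespace MeasureTheory

/-- If `μ ≪ ν`, the Radon-Nikodym derivatives along a filtration generating the whole σ-algebra
converge almost everywhere to the Radon-Nikodym derivative. -/
lemma tendsto_rnDeriv_trim_of_ac {Ω : Type*} [F : MeasurableSpace Ω]
    {Fn : ℕ → MeasurableSpace Ω} (hmono : Monotone Fn) (hle : ∀ n, Fn n ≤ F)
    (hgen : (⨆ n, Fn n) = F) {μ ν : Measure Ω} [IsFiniteMeasure μ] [IsFiniteMeasure ν]
    (hμν : μ ≪ ν) :
    ∀ᵐ x ∂ν, Tendsto (fun n => (μ.trim (hle n)).rnDeriv (ν.trim (hle n)) x) atTop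
      (nhds (μ.rnDeriv ν x)) := by
  let ℱ : Filtration ℕ F := ⟨Fn, hmono, hle⟩
  have hmeas : StronglyMeasurable[⨆ n, ℱ n] fun x => (μ.rnDeriv ν x).toReal := by
    change StronglyMeasurable[⨆ n, Fn n] _
    rw [hgen]
    exact (Measure.measurable_rnDeriv μ ν).ennreal_toReal.stronglyMeasurable
  have hcond : ∀ n, ∀ᵐ x ∂ν, (μ.trim (hle n)).rnDeriv (ν.trim (hle n)) x
      = ENNReal.ofReal (ν[fun x => (μ.rnDeriv ν x).toReal | Fn n] x) :=
    fun n => ae_of_ae_trim (hle n) (rnDeriv_trim (hle n) hμν)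
  filter_upwards [Measure.integrable_toReal_rnDeriv.tendsto_ae_condExp (ℱ := ℱ) hmeas,
    ae_all_iff.2 hcond, μ.rnDeriv_ne_top ν] with x hx hxcond hxtop
  simp_rw [hxcond]
  rw [← ENNReal.ofReal_toReal hxtop]
  exact ENNReal.tendsto_ofReal hx

/-- Without absolute continuity on the whole σ-algebra, the Radon-Nikodym derivatives along a
generating filtration converge almost everywhere to the quotient of the densities with respect to
the sum of the two measures. -/
lemma tendsto_rnDeriv_trim_div {Ω : Type*} [F : MeasurableSpace Ω]
    {Fn : ℕ → MeasurableSpace Ω} (hmono : Monotone Fn) (hle : ∀ n, Fn n ≤ F)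
    (hgen : (⨆ n, Fn n) = F) {μ ν : Measure Ω} [IsFiniteMeasure μ] [IsFiniteMeasure ν]
    (hac : ∀ n, μ.trim (hle n) ≪ ν.trim (hle n)) :
    ∀ᵐ x ∂(μ + ν), Tendsto (fun n => (μ.trim (hle n)).rnDeriv (ν.trim (hle n)) x) atTop
      (nhds (μ.rnDeriv (μ + ν) x / ν.rnDeriv (μ + ν) x)) := by
  have hμ : μ ≪ μ + ν := Measure.AbsolutelyContinuous.rfl.add_right ν
  have hν : ν ≪ μ + ν := Measure.AbsolutelyContinuous.rfl.add_right' μ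
  have hdiv : ∀ n, ∀ᵐ x ∂(μ + ν), (μ.trim (hle n)).rnDeriv (ν.trim (hle n)) x
      = (μ.trim (hle n)).rnDeriv ((μ + ν).trim (hle n)) x
        / (ν.trim (hle n)).rnDeriv ((μ + ν).trim (hle n)) x := by
    intro n
    refine ae_of_ae_trim (hle n) ?_
    rw [trim_add]
    have hsum : μ.trim (hle n) + ν.trim (hle n) ≪ ν.trim (hle n) :=
      (hac n).add_left Measure.AbsolutelyContinuous.rfl
    exact hsum.ae_le (Measure.rnDeriv_eq_div_rnDeriv_add _ _)
  have hpos : ∀ᵐ x ∂(μ + ν), μ.rnDeriv (μ + ν) x ≠ 0 ∨ ν.rnDeriv (μ + ν) x ≠ 0 := by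
    rw [ae_add_measure_iff]
    exact ⟨(Measure.rnDeriv_pos hμ).mono fun x hx => Or.inl hx.ne',
      (Measure.rnDeriv_pos hν).mono fun x hx => Or.inr hx.ne'⟩
  filter_upwards [ae_all_iff.2 hdiv, hpos, tendsto_rnDeriv_trim_of_ac hmono hle hgen hμ,
    tendsto_rnDeriv_trim_of_ac hmono hle hgen hν, μ.rnDeriv_ne_top (μ + ν)]
    with x hxdiv hxpos hxμ hxν hxtop
  simp_rw [hxdiv]
  exact ENNReal.Tendsto.div hxμ hxpos hxν (Or.inr hxtop)

end MeasureTheory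

/-- convergence of Radon–Nikodym derivatives along a filtration and the
Lebesgue decomposition. With `D_n = d(Q|_{F_n})/d(P|_{F_n})`, the sequence `(D_n)`
converges `P`-a.s. (to a finite limit), `Q^{ac}(A) = ∫_A lim_n D_n dP`,
`Q^s(A) = Q(A ∩ {limsup_n D_n = ∞})`, and `Q ≪ P` (resp. `Q ⊥ P`) iff the exceptional
set has `Q`-measure `0` (resp. `1`). -/
theorem rnDeriv_filtration_decomposition
    {Ω : Type*} [F : MeasurableSpace Ω]
    (Fn : ℕ → MeasurableSpace Ω) (hmono : Monotone Fn) (hle : ∀ n, Fn n ≤ F)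
    (hgen : (⨆ n, Fn n) = F)
    (Q P : Measure Ω) [IsProbabilityMeasure Q] [IsProbabilityMeasure P]
    (hac : ∀ n, Q.trim (hle n) ≪ P.trim (hle n)) :
    (∀ᵐ x ∂P, ∃ L : ℝ≥0∞, L ≠ ⊤ ∧
        Tendsto (fun n => (Q.trim (hle n)).rnDeriv (P.trim (hle n)) x) atTop (nhds L)) ∧
    (∀ A : Set Ω, MeasurableSet A →
      P.withDensity (Q.rnDeriv P) A
        = ∫⁻ x in A,
            limsup (fun n => (Q.trim (hle n)).rnDeriv (P.trim (hle n)) x) atTop ∂P) ∧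
    (∀ A : Set Ω, MeasurableSet A →
      Q.singularPart P A
        = Q (A ∩ {x | limsup (fun n => (Q.trim (hle n)).rnDeriv (P.trim (hle n)) x)
            atTop = ⊤})) ∧
    (Q ≪ P ↔
      Q {x | limsup (fun n => (Q.trim (hle n)).rnDeriv (P.trim (hle n)) x) atTop = ⊤} = 0) ∧
    (Q ⟂ₘ P ↔
      Q {x | limsup (fun n => (Q.trim (hle n)).rnDeriv (P.trim (hle n)) x) atTop = ⊤} = 1) := by
  set D : Ω → ℝ≥0∞ := fun x =>
    limsup (fun n => (Q.trim (hle n)).rnDeriv (P.trim (hle n)) x) atTop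
  set S : Set Ω := {x | D x = ⊤}
  have hconv := ae_add_measure_iff.1 (tendsto_rnDeriv_trim_div hmono hle hgen hac)
  have hP : ∀ᵐ x ∂P, Tendsto (fun n => (Q.trim (hle n)).rnDeriv (P.trim (hle n)) x) atTop
      (nhds (Q.rnDeriv P x)) := by
    filter_upwards [hconv.2, Q.rnDeriv_eq_div_rnDeriv_add P] with x hx hxdiv
    rwa [hxdiv]
  have hDP : ∀ᵐ x ∂P, Q.rnDeriv P x = D x := hP.mono fun x hx => hx.limsup_eq.symm
  have hPS : P S = 0 := by
    have h : ∀ᵐ x ∂P, x ∉ S := by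
      filter_upwards [hDP, Q.rnDeriv_ne_top P] with x hx hxtop hxS
      exact hxtop (hx.trans hxS)
    simpa [ae_iff] using h
  have hsingS : Q.singularPart P Sᶜ = 0 := by
    have hsing : Q.singularPart P ≪ Q :=
      (Measure.singularPart_le Q P).absolutelyContinuous
    have hzero : ∀ᵐ x ∂(Q.singularPart P), P.rnDeriv (Q + P) x = 0 :=
      Measure.rnDeriv_eq_zero_of_mutuallySingular
        (Measure.mutuallySingular_singularPart Q P).symm (hsing.add_right P)
    refine ae_iff.1 (?_ : ∀ᵐ x ∂(Q.singularPart P), x ∈ S)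
    filter_upwards [hsing.ae_le hconv.1, hzero, hsing.ae_le
      (Measure.rnDeriv_pos (Measure.AbsolutelyContinuous.rfl.add_right P : Q ≪ Q + P))]
      with x hx hx0 hxpos
    rw [hx0, ENNReal.div_zero hxpos.ne'] at hx
    exact hx.limsup_eq
  have hsing_eq : Q.singularPart P = Q.restrict S := Measure.singularPart_eq_restrict hsingS hPS
  refine ⟨?_, fun A hA => ?_, fun A hA => ?_, ?_, ?_⟩
  · filter_upwards [hP, Q.rnDeriv_ne_top P] with x hx hxtop
    exact ⟨_, hxtop, hx⟩
  · rw [withDensity_apply _ hA]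
    exact lintegral_congr_ae (ae_restrict_of_ae hDP)
  · rw [hsing_eq, Measure.restrict_apply hA]
  · rw [← Measure.singularPart_eq_zero, hsing_eq, Measure.restrict_eq_zero]
  · rw [← Measure.singularPart_eq_self, hsing_eq]
    refine ⟨fun h => ?_, fun h => ?_⟩
    · rw [← Measure.restrict_apply_univ, h, measure_univ]
    · have hDmeas : Measurable D := Measurable.limsup fun n =>
        (Measure.measurable_rnDeriv (Q.trim (hle n)) (P.trim (hle n))).mono (hle n) le_rfl
      exact Measure.restrict_eq_self_of_ae_mem
        ((mem_ae_iff_prob_eq_one (hDmeas (measurableSet_singleton ⊤))).2 h)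
end
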